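/- Let B be a Noetherian local ring, M a finite B-module satisfying (S_n), and N a finite B-module satisfying (S'_n). If every minimal prime of M is a minimal prime of N, then M satisfies (S'_n). -/

import Mathlib

open CategoryTheory

/-- Depth via local cohomology at the maximal ideal (following the paper). -/
noncomputable def localDepth (A : Type) [CommRing A] [IsLocalRing A]
    (M : Type) [AddCommGroup M] [Module A M] : ℕ∞ :=
  sInf {n : ℕ∞ | ∃ m : ℕ, n = (m : ℕ∞) ∧
    Nontrivial ((localCohomology (IsLocalRing.maximalIdeal A) m).obj (ModuleCat.of A M))}

/-- `depth_{A_P} M_P` for a prime `P`. -/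
noncomputable def primeLocalDepth (A : Type) [CommRing A] (P : Ideal A)
    (hP : P.IsPrime) (M : Type) [AddCommGroup M] [Module A M] : ℕ∞ :=
  haveI := hP
  localDepth (Localization.AtPrime P) (LocalizedModule P.primeCompl M)

/-- `dim A_P`, the height of the prime `P`. -/
noncomputable def primeKrullDim (A : Type) [CommRing A] (P : Ideal A)
    (hP : P.IsPrime) : WithBot ℕ∞ :=
  haveI := hP
  ringKrullDim (Localization.AtPrime P)

/-- `dim M_P`, the dimension of the localized module. -/
noncomputable def primeModuleDim (A : Type) [CommRing A] (P : Ideal A)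
    (hP : P.IsPrime) (M : Type) [AddCommGroup M] [Module A M] : WithBot ℕ∞ :=
  haveI := hP
  Order.krullDim
    (Module.support (Localization.AtPrime P) (LocalizedModule P.primeCompl M))

/-- Serre's condition `(S_n)`: `depth M_P ≥ min (n, dim M_P)` for all primes `P`. -/
def SerreS (A : Type) [CommRing A] (M : Type) [AddCommGroup M] [Module A M]
    (n : ℕ) : Prop :=
  ∀ (P : Ideal A) (hP : P.IsPrime),
    min (n : WithBot ℕ∞) (primeModuleDim A P hP M) ≤
      (primeLocalDepth A P hP M : WithBot ℕ∞)

/-- Serre's condition `(S'_n)`: `depth M_P ≥ min (n, dim A_P)` for all primes `P`. -/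
def SerreS' (A : Type) [CommRing A] (M : Type) [AddCommGroup M] [Module A M]
    (n : ℕ) : Prop :=
  ∀ (P : Ideal A) (hP : P.IsPrime),
    min (n : WithBot ℕ∞) (primeKrullDim A P hP) ≤
      (primeLocalDepth A P hP M : WithBot ℕ∞)

/-- `P` is a minimal prime of (the support of) the module `M`. -/
def IsMinimalSupportPrime (A : Type) [CommRing A]
    (M : Type) [AddCommGroup M] [Module A M] (P : PrimeSpectrum A) : Prop :=
  P ∈ Module.support A M ∧
    ∀ Q ∈ Module.support A M, Q ≤ P → Q = P

section

namespace HomologicalComplex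

open Limits

variable {C : Type*} [Category* C] [Abelian C] {ι : Type*} {c : ComplexShape ι}

lemma exists_eq_d_comp_of_homologyι_comp_eq_zero (K : HomologicalComplex C c) (i j : ι)
    (hj : c.next i = j) {T : C} [Injective T] (f : K.opcycles i ⟶ T)
    (h : K.homologyι i ≫ f = 0) : ∃ g : K.X j ⟶ T, K.pOpcycles i ≫ f = K.d i j ≫ g := by
  let S := ShortComplex.mk (K.homologyι i) (K.fromOpcycles i j) (by simp)
  have hS : S.Exact := ShortComplex.exact_of_f_is_kernel _ (K.homologyIsKernel i j hj)
  refine ⟨hS.descToInjective f h, ?_⟩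
  have := hS.comp_descToInjective f h
  dsimp [S] at this ⊢
  rw [← K.p_fromOpcycles, Category.assoc, this]

end HomologicalComplex

namespace CategoryTheory.ProjectiveResolution

open Limits Opposite

universe u
variable {R : Type u} [CommRing R]

instance : Injective (op (ModuleCat.of R R)) := by
  have : Projective (ModuleCat.of R R) := inferInstance
  infer_instance

/-- The linear map from `R` to the morphisms `P.complex.X i ⟶ Y` with value `φ` at `1`, seen as a
morphism in the opposite category. -/
noncomputable abbrev opSpan {X Y : ModuleCat.{u} R} (φ : X ⟶ Y) :
    ((linearYoneda R (ModuleCat.{u} R)).obj Y).rightOp.obj X ⟶ op (ModuleCat.of R R) :=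
  (ModuleCat.ofHom (LinearMap.toSpanSingleton R (X ⟶ Y) φ)).op

lemma rightOp_map_comp_opSpan {X X' Y : ModuleCat.{u} R} (f : X' ⟶ X) (φ : X ⟶ Y) :
    ((linearYoneda R (ModuleCat.{u} R)).obj Y).rightOp.map f ≫ opSpan φ = opSpan (f ≫ φ) := by
  apply Quiver.Hom.unop_inj
  ext
  change f ≫ ((1 : R) • φ) = (1 : R) • (f ≫ φ)
  simp

lemma opSpan_zero {X Y : ModuleCat.{u} R} : opSpan (0 : X ⟶ Y) = 0 := by
  apply Quiver.Hom.unop_inj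
  ext
  exact smul_zero (A := X ⟶ Y) (1 : R)

variable {X X' Y : ModuleCat.{u} R} (P : ProjectiveResolution X) (P' : ProjectiveResolution X')

/-- The complex computing `Ext` into `Y`, in the opposite category. -/
noncomputable abbrev opHomComplex (Y : ModuleCat.{u} R) : ChainComplex (ModuleCat.{u} R)ᵒᵖ ℕ :=
  (((linearYoneda R (ModuleCat.{u} R)).obj Y).rightOp.mapHomologicalComplex _).obj P.complex

lemma d_comp_opSpan {i : ℕ} (φ : P.complex.X i ⟶ Y)
    (hφ : P.complex.d (i + 1) i ≫ φ = 0) :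
    (P.opHomComplex Y).d (i + 1) i ≫ opSpan φ = 0 :=
  (rightOp_map_comp_opSpan _ φ).trans (by rw [hφ]; exact opSpan_zero)

variable {i : ℕ} (φ : P.complex.X i ⟶ Y) (hφ : P.complex.d (i + 1) i ≫ φ = 0)

/-- The morphism in the opposite category corresponding to the linear map from `R` to
`Ext R _ i X Y` whose value at `1` is the class of a cocycle `φ`. -/
noncomputable def opCocycleClass :
    (((linearYoneda R (ModuleCat.{u} R)).obj Y).rightOp.leftDerived i).obj X ⟶
      op (ModuleCat.of R R) :=
  (P.isoLeftDerivedObj _ i).hom ≫ (P.opHomComplex Y).homologyι i ≫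
    (P.opHomComplex Y).descOpcycles (opSpan φ) (i + 1) (by simp) (P.d_comp_opSpan φ hφ)

/-- The class of a cocycle in `Ext`. -/
noncomputable def cocycleToExt : ((Ext R (ModuleCat.{u} R) i).obj (op X)).obj Y :=
  (P.opCocycleClass φ hφ).unop (1 : R)

lemma exists_eq_d_comp_of_map_cocycleToExt_eq_zero
    (e : X' ⟶ X) (g : P'.complex ⟶ P.complex) (hg : g.f 0 ≫ P.π.f 0 = P'.π.f 0 ≫ e)
    (h : ((Ext R (ModuleCat.{u} R) i).map e.op).app Y (P.cocycleToExt φ hφ) = 0) :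
    ∃ θ : P'.complex.X (i - 1) ⟶ Y, g.f i ≫ φ = P'.complex.d i (i - 1) ≫ θ := by
  let F := ((linearYoneda R (ModuleCat.{u} R)).obj Y).rightOp
  let G := (F.mapHomologicalComplex (ComplexShape.down ℕ)).map g
  let δ := (P.opHomComplex Y).descOpcycles (opSpan φ) (i + 1) (by simp) (P.d_comp_opSpan φ hφ)
  have h0 : (F.leftDerived i).map e ≫ P.opCocycleClass φ hφ = 0 := by
    apply Quiver.Hom.unop_inj
    ext
    exact h
  have h1 : (P'.opHomComplex Y).homologyι i ≫ HomologicalComplex.opcyclesMap G i ≫ δ = 0 := by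
    have h2 := (isoLeftDerivedObj_hom_naturality_assoc e P' P g hg F i
      ((P.opHomComplex Y).homologyι i ≫ δ)).symm.trans h0
    have h3 := (cancel_epi (P'.isoLeftDerivedObj F i).hom).1 (h2.trans Limits.comp_zero.symm)
    exact (HomologicalComplex.homologyι_naturality_assoc G i δ).symm.trans h3
  obtain ⟨θ, hθ⟩ := HomologicalComplex.exists_eq_d_comp_of_homologyι_comp_eq_zero
    (P'.opHomComplex Y) i (i - 1) (by cases i <;> simp) _ h1
  have h2 : opSpan (g.f i ≫ φ) = (P'.opHomComplex Y).d i (i - 1) ≫ θ := by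
    refine Eq.trans ?_ hθ
    rw [HomologicalComplex.p_opcyclesMap_assoc]
    refine (rightOp_map_comp_opSpan (g.f i) φ).symm.trans (congrArg (G.f i ≫ ·) ?_)
    exact ((P.opHomComplex Y).p_descOpcycles _ _ _ _).symm
  refine ⟨θ.unop (1 : R), ?_⟩
  have h3 := ConcreteCategory.congr_hom (congrArg Quiver.Hom.unop h2) (1 : R)
  exact (one_smul R (g.f i ≫ φ)).symm.trans h3

end CategoryTheory.ProjectiveResolution

universe u
variable {R : Type u} [CommRing R]

open Limits Opposite

namespace localCohomology

/-- The chosen projective resolution of `R ⧸ J ^ t`. -/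
noncomputable abbrev powRes (J : Ideal R) (t : ℕ) :
    ProjectiveResolution ((ringModIdeals (idealPowersDiagram J)).obj (op t)) :=
  projectiveResolution _

/-- The augmentation of the chosen projective resolution of `R ⧸ J ^ t`. -/
noncomputable def powAug (J : Ideal R) (t : ℕ) :
    (powRes J t).complex.X 0 ⟶ (ringModIdeals (idealPowersDiagram J)).obj (op t) :=
  (powRes J t).π.f 0

instance (J : Ideal R) (t : ℕ) : Epi (powAug J t) :=
  inferInstanceAs (Epi ((powRes J t).π.f 0))

lemma d_comp_powAug (J : Ideal R) (t : ℕ) : (powRes J t).complex.d 1 0 ≫ powAug J t = 0 :=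
  (powRes J t).complex_d_comp_π_f_zero

/-- Every degree `i` cocycle on one of the resolutions of the `R ⧸ J ^ t` becomes a coboundary
after pulling back to the resolution of some `R ⧸ J ^ s`. -/
def CocyclesVanish (J : Ideal R) (i : ℕ) (N : ModuleCat.{u} R) : Prop :=
  ∀ (t : ℕ) (φ : (powRes J t).complex.X i ⟶ N), (powRes J t).complex.d (i + 1) i ≫ φ = 0 →
    ∃ (s : ℕ) (e : (ringModIdeals (idealPowersDiagram J)).obj (op s) ⟶
        (ringModIdeals (idealPowersDiagram J)).obj (op t))
      (g : (powRes J s).complex ⟶ (powRes J t).complex)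
      (θ : (powRes J s).complex.X (i - 1) ⟶ N),
      Epi e ∧ g.f 0 ≫ powAug J t = powAug J s ≫ e ∧
      g.f i ≫ φ = (powRes J s).complex.d i (i - 1) ≫ θ

variable {J : Ideal R}

lemma CocyclesVanish.of_subsingleton {i : ℕ} {N : ModuleCat.{u} R}
    (h : Subsingleton ((localCohomology J i).obj N)) : CocyclesVanish J i N := by
  intro t φ hφ
  let D := diagram (idealPowersDiagram J) i
  have hc : IsColimit (((evaluation _ _).obj N).mapCocone (colimit.cocone D)) :=
    isColimitOfPreserves _ (colimit.isColimit D)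
  have : PreservesFilteredColimitsOfSize.{0, 0} (forget (ModuleCat.{u} R)) :=
    preservesFilteredColimitsOfSize_shrink.{0, u, 0, u} _
  let z := (powRes J t).cocycleToExt φ hφ
  obtain ⟨k, f, f', hf⟩ := Concrete.isColimit_exists_of_rep_eq (i := op (op t)) (j := op (op t))
    _ hc z 0 (@Subsingleton.elim _ h _ _)
  let s := k.unop.unop
  let e := (ringModIdeals (idealPowersDiagram J)).map f.unop
  refine ⟨s, e, ProjectiveResolution.lift e _ _, ?_⟩
  have hg := ProjectiveResolution.lift_commutes_zero e (powRes J s) (powRes J t)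
  obtain ⟨θ, hθ⟩ := ProjectiveResolution.exists_eq_d_comp_of_map_cocycleToExt_eq_zero
    (powRes J t) (powRes J s) φ hφ e _ hg (hf.trans (map_zero _))
  refine ⟨θ, ?_, hg, hθ⟩
  rw [ModuleCat.epi_iff_surjective]
  intro y
  obtain ⟨y, rfl⟩ := Submodule.Quotient.mk_surjective _ y
  exact ⟨Submodule.Quotient.mk y, rfl⟩

lemma CocyclesVanish.of_shortExact {i : ℕ} {S : ShortComplex (ModuleCat.{u} R)}
    (hS : S.ShortExact) (h₂ : CocyclesVanish J i S.X₂) (h₁ : CocyclesVanish J (i + 1) S.X₁) :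
    CocyclesVanish J i S.X₃ := by
  intro t φ hφ
  have := hS.mono_f
  have := hS.epi_g
  let φ₂ := Projective.factorThru φ S.g
  have hφ₂ : φ₂ ≫ S.g = φ := Projective.factorThru_comp φ S.g
  let ψ : (powRes J t).complex.X (i + 1) ⟶ S.X₁ :=
    hS.exact.lift ((powRes J t).complex.d (i + 1) i ≫ φ₂) (by rw [Category.assoc, hφ₂, hφ])
  have hψ : ψ ≫ S.f = (powRes J t).complex.d (i + 1) i ≫ φ₂ := hS.exact.lift_f _ _
  obtain ⟨s, e, g, θ, he, hg, hθ⟩ := h₁ t ψ (by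
    rw [← cancel_mono S.f, Category.assoc, hψ]; simp)
  change (powRes J s).complex.X i ⟶ _ at θ
  change _ = (powRes J s).complex.d (i + 1) i ≫ θ at hθ
  obtain ⟨s', e', g', θ', he', hg', hθ'⟩ := h₂ s (g.f i ≫ φ₂ - θ ≫ S.f) (by
    rw [Preadditive.comp_sub, ← Category.assoc _ θ, ← hθ, Category.assoc, hψ]
    simp)
  refine ⟨s', e' ≫ e, g' ≫ g, θ' ≫ S.g, epi_comp _ _, ?_, ?_⟩
  · rw [HomologicalComplex.comp_f, Category.assoc, hg, reassoc_of% hg']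
  · rw [← reassoc_of% hθ']
    simp [hφ₂]

lemma CocyclesVanish.subsingleton_hom {N : ModuleCat.{u} R} (h : CocyclesVanish J 0 N)
    (t : ℕ) : Subsingleton ((R ⧸ J ^ t) →ₗ[R] N) := by
  suffices ∀ f : (R ⧸ J ^ t) →ₗ[R] N, f = 0 from ⟨fun f g ↦ (this f).trans (this g).symm⟩
  intro f
  let f' : (ringModIdeals (idealPowersDiagram J)).obj (op t) ⟶ N := ModuleCat.ofHom f
  obtain ⟨s, e, g, θ, he, hg, hθ⟩ := h t (powAug J t ≫ f') (by
    rw [← Category.assoc, d_comp_powAug, zero_comp])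
  have h0 : (powRes J s).complex.d 0 (0 - 1) = 0 := (powRes J s).complex.shape _ _ (by simp)
  rw [h0, zero_comp, reassoc_of% hg] at hθ
  have : f' = 0 := by
    rw [← cancel_epi e, ← cancel_epi (powAug J s), hθ]
    simp
  exact congrArg ModuleCat.Hom.hom this

lemma subsingleton_of_subsingleton (i : ℕ) (N : ModuleCat.{u} R) [Subsingleton N] :
    Subsingleton ((localCohomology J i).obj N) := by
  let D := diagram (idealPowersDiagram J) i
  have hc : IsColimit (((evaluation _ _).obj N).mapCocone (colimit.cocone D)) :=
    isColimitOfPreserves _ (colimit.isColimit D)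
  have : PreservesFilteredColimitsOfSize.{0, 0} (forget (ModuleCat.{u} R)) :=
    preservesFilteredColimitsOfSize_shrink.{0, u, 0, u} _
  suffices ∀ x : (localCohomology J i).obj N, x = 0 from
    ⟨fun x y ↦ (this x).trans (this y).symm⟩
  intro x
  obtain ⟨k, y, rfl⟩ := Concrete.isColimit_exists_rep _ hc x
  have hz : IsZero (((Ext R (ModuleCat.{u} R) i).obj
      (op ((ringModIdeals (idealPowersDiagram J)).obj k.unop))).obj N) := by
    refine IsZero.of_iso ?_ ((projectiveResolution _).isoExt i N)
    rw [← HomologicalComplex.exactAt_iff_isZero_homology, HomologicalComplex.exactAt_iff]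
    refine ShortComplex.exact_of_isZero_X₂ _ ?_
    refine @ModuleCat.isZero_of_subsingleton _ _ _ ?_
    exact ⟨fun f g ↦ (ModuleCat.isZero_of_subsingleton N).eq_of_tgt f g⟩
  have hy : y = 0 := @Subsingleton.elim _ (ModuleCat.subsingleton_of_isZero hz) y 0
  rw [hy]
  exact map_zero (ModuleCat.Hom.hom _)

end localCohomology

end

open Pointwise in
lemma exists_associatedPrimes_quotSMulTop_lt {R : Type*} [CommRing R] [IsNoetherianRing R]
    [IsLocalRing R] {N : Type*} [AddCommGroup N] [Module R N] [Module.Finite R N]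
    {x : R} (hx : x ∈ IsLocalRing.maximalIdeal R) (hreg : IsSMulRegular N x)
    {Q : Ideal R} (hQ : Q ∈ associatedPrimes R N) :
    ∃ Q' ∈ associatedPrimes R (QuotSMulTop x N), Q < Q' := by
  obtain ⟨hQp, y, hy⟩ := isAssociatedPrime_iff.1 hQ
  have hQy (q : R) : q ∈ Q ↔ q • y = 0 := by
    rw [hy, Submodule.mem_colon_singleton, Submodule.mem_bot]
  have hy0 : y ≠ 0 := fun h ↦ hQp.ne_top ((Ideal.eq_top_iff_one _).2 ((hQy 1).2 (by simp [h])))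
  have hxQ : x ∉ Q := fun h ↦ hy0 (hreg (by simpa using (hQy x).1 h))
  let W : Submodule R N := Submodule.torsionBySet R N Q
  have hyW : y ∈ W := (Submodule.mem_torsionBySet_iff _ _).2 fun q ↦ (hQy q).1 q.2
  obtain ⟨w, hw, hwx⟩ : ∃ w ∈ W, w ∉ x • (⊤ : Submodule R N) := by
    by_contra! hc
    have hW : W = ⊥ := by
      refine Submodule.eq_bot_of_le_smul_of_le_jacobson_bot (Ideal.span {x}) W
        (IsNoetherian.noetherian W) (fun w hw ↦ ?_) ?_
      · obtain ⟨n, -, rfl⟩ := (Submodule.mem_smul_pointwise_iff_exists _ _ _).1 (hc w hw)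
        refine Submodule.smul_mem_smul (Ideal.mem_span_singleton_self x) ?_
        refine (Submodule.mem_torsionBySet_iff _ _).2 fun q ↦ hreg ?_
        have := (Submodule.mem_torsionBySet_iff _ _).1 hw q
        simpa [smul_comm x] using this
      · rw [IsLocalRing.jacobson_eq_maximalIdeal _ bot_ne_top]
        exact (Ideal.span_singleton_le_iff_mem _).2 hx
    exact hy0 (by simpa [hW] using hyW)
  obtain ⟨Q', hQ', hle⟩ := exists_le_isAssociatedPrime_of_isNoetherianRing R
    (Submodule.Quotient.mk w : QuotSMulTop x N)
    (fun h ↦ hwx ((Submodule.Quotient.mk_eq_zero _).1 h))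
  have hmem (r : R) (hr : r • w ∈ x • (⊤ : Submodule R N)) : r ∈ Q' := hle <| by
    rw [Submodule.mem_colon_singleton, Submodule.mem_bot, ← Submodule.Quotient.mk_smul]
    exact (Submodule.Quotient.mk_eq_zero _).2 hr
  refine ⟨Q', hQ', SetLike.lt_iff_le_and_exists.2 ⟨fun q hq ↦ hmem q ?_, x, hmem x ?_, hxQ⟩⟩
  · rw [(Submodule.mem_torsionBySet_iff _ _).1 hw ⟨q, hq⟩]
    exact zero_mem _
  · exact Submodule.smul_mem_pointwise_smul _ _ _ trivial

namespace localCohomology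

open IsLocalRing

universe u in
lemma le_coheight_of_cocyclesVanish {R : Type u} [CommRing R] [IsNoetherianRing R] [IsLocalRing R]
    (d : ℕ) (N : ModuleCat.{u} R) [Module.Finite R N]
    (h : ∀ i < d, CocyclesVanish (maximalIdeal R) i N) (Q : PrimeSpectrum R)
    (hQ : Q.asIdeal ∈ associatedPrimes R N) : (d : ℕ∞) ≤ Order.coheight Q := by
  induction d generalizing N Q with
  | zero => simp
  | succ d ih =>
    obtain ⟨x, hx, hreg⟩ := (IsSMulRegular.subsingleton_linearMap_iff (M := N)).1
      ((h 0 d.succ_pos).subsingleton_hom 1)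
    rw [pow_one, Ideal.annihilator_quotient] at hx
    obtain ⟨Q', hQ', hlt⟩ := exists_associatedPrimes_quotSMulTop_lt hx hreg hQ
    have := ih (ModuleCat.of R (QuotSMulTop x N)) (fun i hi ↦
      .of_shortExact hreg.smulShortComplex_shortExact (h i (by omega)) (h (i + 1) (by omega)))
      ⟨Q', hQ'.isPrime⟩ hQ'
    calc ((d + 1 : ℕ) : ℕ∞) ≤ Order.coheight (⟨Q', hQ'.isPrime⟩ : PrimeSpectrum R) + 1 := by
          push_cast; gcongr
      _ ≤ _ := Order.coheight_add_one_le hlt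

end localCohomology

lemma localDepth_eq_top_of_subsingleton (A : Type) [CommRing A] [IsLocalRing A]
    (M : Type) [AddCommGroup M] [Module A M] [Subsingleton M] : localDepth A M = ⊤ := by
  refine sInf_eq_top.2 ?_
  rintro _ ⟨m, -, hm⟩
  exact absurd (localCohomology.subsingleton_of_subsingleton m (ModuleCat.of A M))
    (not_subsingleton_iff_nontrivial.2 hm)

lemma localDepth_le_coheight (A : Type) [CommRing A] [IsNoetherianRing A] [IsLocalRing A]
    (N : Type) [AddCommGroup N] [Module A N] [Module.Finite A N] (Q : PrimeSpectrum A)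
    (hQ : Q.asIdeal ∈ associatedPrimes A N) : localDepth A N ≤ Order.coheight Q := by
  refine ENat.forall_natCast_le_iff_le.1 fun d hd ↦ ?_
  refine localCohomology.le_coheight_of_cocyclesVanish d (ModuleCat.of A N) (fun i hi ↦ ?_) Q hQ
  refine .of_subsingleton (not_nontrivial_iff_subsingleton.1 fun hn ↦ ?_)
  exact (Nat.cast_lt.2 hi).not_ge (hd.trans (sInf_le ⟨i, rfl, hn⟩))

lemma coheight_le_krullDim_support {A : Type*} [CommRing A] {M : Type*} [AddCommGroup M]
    [Module A M] {Q : PrimeSpectrum A} (hQ : Q ∈ Module.support A M) :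
    (Order.coheight Q : WithBot ℕ∞) ≤ Order.krullDim (Module.support A M) := by
  rw [Order.coheight_eq_krullDim_Ici]
  exact Order.krullDim_le_of_strictMono
    (fun p ↦ ⟨p.1, Module.mem_support_mono p.2 hQ⟩) fun _ _ h ↦ h

lemma IsMinimalSupportPrime.mem_associatedPrimes {A : Type} [CommRing A] [IsNoetherianRing A]
    {M : Type} [AddCommGroup M] [Module A M] [Module.Finite A M] {Q : PrimeSpectrum A}
    (h : IsMinimalSupportPrime A M Q) : Q.asIdeal ∈ associatedPrimes A M := by
  refine Module.associatedPrimes.minimalPrimes_annihilator_subset_associatedPrimes A M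
    ⟨⟨Q.isPrime, Module.annihilator_le_of_mem_support h.1⟩, fun q hq hle ↦ ?_⟩
  have hq' : (⟨q, hq.1⟩ : PrimeSpectrum A) ∈ Module.support A M := by
    rw [Module.support_eq_zeroLocus]
    exact hq.2
  exact (congrArg PrimeSpectrum.asIdeal (h.2 _ hq' hle)).ge

lemma exists_isMinimalSupportPrime_le {A : Type} [CommRing A]
    {M : Type} [AddCommGroup M] [Module A M] [Module.Finite A M] {P : PrimeSpectrum A}
    (h : P ∈ Module.support A M) : ∃ Q ≤ P, IsMinimalSupportPrime A M Q := by
  have := P.isPrime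
  obtain ⟨q, hq, hle⟩ := Ideal.exists_minimalPrimes_le (Module.annihilator_le_of_mem_support h)
  refine ⟨⟨q, hq.1.1⟩, hle, ?_, fun Q hQ hle ↦ le_antisymm hle ?_⟩
  · rw [Module.support_eq_zeroLocus]
    exact hq.1.2
  · exact hq.2 ⟨Q.isPrime, Module.annihilator_le_of_mem_support hQ⟩ hle

/-- **Corollary (Ischebeck).**
Let `B` be a Noetherian local ring, `M` a finite `B`-module satisfying `(S_n)`, and
`N` a finite `B`-module satisfying `(S'_n)`.  If every minimal prime of `M` is a
minimal prime of `N`, then `M` satisfies `(S'_n)`. -/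
theorem serreS'_of_serreS_of_minimal_primes
    (B : Type) [CommRing B] [IsNoetherianRing B] [IsLocalRing B]
    (M : Type) [AddCommGroup M] [Module B M] [Module.Finite B M]
    (N : Type) [AddCommGroup N] [Module B N] [Module.Finite B N]
    (n : ℕ) (hM : SerreS B M n) (hN : SerreS' B N n)
    (hmin : ∀ P : PrimeSpectrum B,
      IsMinimalSupportPrime B M P → IsMinimalSupportPrime B N P) :
    SerreS' B M n := by
  intro P hP
  let A := Localization.AtPrime P
  obtain hs | hs := subsingleton_or_nontrivial (LocalizedModule P.primeCompl M)
  · unfold primeLocalDepth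
    rw [localDepth_eq_top_of_subsingleton]
    exact le_top
  obtain ⟨Q, hQP, hQM⟩ := exists_isMinimalSupportPrime_le (P := ⟨P, hP⟩)
    (Module.mem_support_iff.2 hs)
  have hdisj : Disjoint (P.primeCompl : Set B) Q.asIdeal :=
    Set.disjoint_left.2 fun _ hx hxQ ↦ hx (hQP hxQ)
  have hcomap : (Q.asIdeal.map (algebraMap B A)).comap (algebraMap B A) = Q.asIdeal :=
    IsLocalization.under_map_of_isPrime_disjoint P.primeCompl A Q.isPrime hdisj
  let Q' : PrimeSpectrum A := ⟨Q.asIdeal.map (algebraMap B A),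
    IsLocalization.isPrime_of_isPrime_disjoint P.primeCompl A _ Q.isPrime hdisj⟩
  have hass {L : Type} [AddCommGroup L] [Module B L] [Module.Finite B L]
      (hL : IsMinimalSupportPrime B L Q) :
      Q'.asIdeal ∈ associatedPrimes A (LocalizedModule P.primeCompl L) :=
    Module.associatedPrimes.mem_associatedPrimes_of_comap_mem_associatedPrimes_of_isLocalizedModule
      P.primeCompl (LocalizedModule.mkLinearMap P.primeCompl L) _
      (by rw [hcomap]; exact hL.mem_associatedPrimes)
  have hQ' : Q' ∈ Module.support A (LocalizedModule P.primeCompl M) := by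
    rw [Module.support_eq_zeroLocus, ← Submodule.annihilator_top]
    exact (hass hQM).annihilator_le
  have hdepth := localDepth_le_coheight A _ Q' (hass (hmin Q hQM))
  refine (le_min (min_le_left _ _) ?_).trans (hM P hP)
  calc _ ≤ (primeLocalDepth B P hP N : WithBot ℕ∞) := hN P hP
    _ ≤ (Order.coheight Q' : WithBot ℕ∞) := WithBot.coe_le_coe.2 hdepth
    _ ≤ primeModuleDim B P hP M := coheight_le_krullDim_support hQ'
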